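/- arXiv:2310.11387 — 2 statements merged into one kernel-verified Lean document; each statement's English description precedes it below -/
import Mathlib

section
/- Every type 1 toggle in T(𝓛) commutes with every type 2 toggle in T(𝓛). -/
open scoped symmDiff

namespace TogglePaper

variable {E : Type*} [DecidableEq E]

/-- The toggle `τ_e` on the collection `L` of subsets of the ground set. -/
def toggle (L : Finset (Finset E)) (e : E) : Equiv.Perm {A : Finset E // A ∈ L} :=
  Function.Involutive.toPerm
    (fun X => if h : X.1 ∆ ({e} : Finset E) ∈ L then ⟨X.1 ∆ ({e} : Finset E), h⟩ else X)
    (by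
      intro X
      by_cases h : X.1 ∆ ({e} : Finset E) ∈ L
      · have h2 : (X.1 ∆ ({e} : Finset E)) ∆ ({e} : Finset E) = X.1 :=
          symmDiff_symmDiff_cancel_right _ _
        simp only [dif_pos h, h2]
        simp [h2, X.2]
      · simp [h])

/-- The generalized toggle group `T(L)`. -/
def toggleGroup (L : Finset (Finset E)) : Subgroup (Equiv.Perm {A : Finset E // A ∈ L}) :=
  Subgroup.closure (Set.range (toggle L))

/-- `T(L)` acts transitively on `L`. -/
def IsTransitive (L : Finset (Finset E)) : Prop :=
  ∀ A B : {A : Finset E // A ∈ L}, ∃ g ∈ toggleGroup L, g A = B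

/-- `B` is a block for the action of `T(L)` on `L`. -/
def IsBlock (L : Finset (Finset E)) (B : Finset {A : Finset E // A ∈ L}) : Prop :=
  ∀ g ∈ toggleGroup L, Finset.image g B = B ∨ Disjoint (Finset.image g B) B

/-- `Blocks` is a block system for `T(L)`: a partition of `L` into nonempty blocks
that is permuted by every element of `T(L)`. -/
def IsBlockSystem (L : Finset (Finset E))
    (Blocks : Finset (Finset {A : Finset E // A ∈ L})) : Prop :=
  (∀ B ∈ Blocks, B.Nonempty) ∧
  (∀ A : {A : Finset E // A ∈ L}, ∃! B : Finset {A : Finset E // A ∈ L},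
      B ∈ Blocks ∧ A ∈ B) ∧
  (∀ g ∈ toggleGroup L, ∀ B ∈ Blocks, Finset.image g B ∈ Blocks)

/-- An element `g` of `T(L)` is type 2 (with respect to a fixed block system `Blocks`)
if it maps each block to itself; it is type 1 otherwise. -/
def IsType2 (L : Finset (Finset E)) (Blocks : Finset (Finset {A : Finset E // A ∈ L}))
    (g : Equiv.Perm {A : Finset E // A ∈ L}) : Prop :=
  ∀ B ∈ Blocks, Finset.image g B = B

/-- The action of `T(L)` on `L` is primitive: it is transitive and the only blocks
are the singletons, the empty set and the whole set. -/
def IsPrimitive (L : Finset (Finset E)) : Prop :=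
  IsTransitive L ∧
    ∀ B : Finset {A : Finset E // A ∈ L}, IsBlock L B → B.card ≤ 1 ∨ B = Finset.univ

/-- `T(L)` contains a long cycle, i.e. a cycle whose support is all of `L`. -/
def HasLongCycle (L : Finset (Finset E)) : Prop :=
  ∃ g ∈ toggleGroup L, g.IsCycle ∧ g.support = Finset.univ

theorem toggle_toggle (L : Finset (Finset E)) (e : E) (A : {A : Finset E // A ∈ L}) :
    toggle L e (toggle L e A) = A :=
  Function.Involutive.toPerm_involutive _ A

theorem toggle_apply (L : Finset (Finset E)) (e : E) (A : {A : Finset E // A ∈ L}) :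
    toggle L e A = if h : A.1 ∆ {e} ∈ L then ⟨A.1 ∆ {e}, h⟩ else A :=
  rfl

theorem coe_toggle_of_mem {L : Finset (Finset E)} {e : E} {A : {A : Finset E // A ∈ L}}
    (h : A.1 ∆ {e} ∈ L) : (toggle L e A : Finset E) = A.1 ∆ {e} := by
  rw [toggle_apply, dif_pos h]

theorem coe_toggle_of_ne {L : Finset (Finset E)} {e : E} {A : {A : Finset E // A ∈ L}}
    (h : toggle L e A ≠ A) : (toggle L e A : Finset E) = A.1 ∆ {e} := by
  by_cases hA : A.1 ∆ {e} ∈ L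
  · exact coe_toggle_of_mem hA
  · exact absurd (by rw [toggle_apply, dif_neg hA]) h

theorem toggle_comm_of_ne {L : Finset (Finset E)} {x y : E} {A : {A : Finset E // A ∈ L}}
    (hx : toggle L x A ≠ A) (hy : toggle L y A ≠ A)
    (hyx : toggle L y (toggle L x A) ≠ toggle L x A) :
    toggle L y (toggle L x A) = toggle L x (toggle L y A) := by
  have h : (toggle L y A).1 ∆ {x} = (toggle L y (toggle L x A)).1 := by
    rw [coe_toggle_of_ne hyx, coe_toggle_of_ne hx, coe_toggle_of_ne hy, symmDiff_right_comm]
  have hmem : (toggle L y A).1 ∆ {x} ∈ L := h ▸ (toggle L y (toggle L x A)).2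
  exact Subtype.ext (by rw [coe_toggle_of_mem hmem, h])

section BlockMap

variable {L : Finset (Finset E)} {α : Type*} {b : {A : Finset E // A ∈ L} → α}

/-- A toggle that moves a point inside its fibre preserves every fibre. -/
theorem apply_toggle_eq_of_ne (htrans : IsTransitive L)
    (hb : ∀ e A B, b A = b B → b (toggle L e A) = b (toggle L e B)) {y : E}
    {A : {A : Finset E // A ∈ L}} (hne : toggle L y A ≠ A) (hA : b (toggle L y A) = b A)
    (B : {A : Finset E // A ∈ L}) : b (toggle L y B) = b B := by
  have hstep : ∀ z C, (∃ D, b D = b C ∧ toggle L y D ≠ D ∧ b (toggle L y D) = b D) →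
      ∃ D, b D = b (toggle L z C) ∧ toggle L y D ≠ D ∧ b (toggle L y D) = b D := by
    rintro z C ⟨D, hDC, hD, hbD⟩
    by_cases hz : b (toggle L z D) = b D
    · exact ⟨D, hz.symm.trans (hb z _ _ hDC), hD, hbD⟩
    · have hcomm : toggle L z (toggle L y D) = toggle L y (toggle L z D) :=
        toggle_comm_of_ne hD (fun h => hz (congrArg b h))
          (fun h => hz ((hb z _ _ hbD).symm.trans ((congrArg b h).trans hbD)))
      refine ⟨toggle L z D, hb z _ _ hDC, ?_, ?_⟩
      · rw [← hcomm]
        exact fun h => hD ((toggle L z).injective h)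
      · rw [← hcomm]
        exact hb z _ _ hbD
  have hgroup : ∀ g ∈ toggleGroup L, ∀ C,
      (∃ D, b D = b C ∧ toggle L y D ≠ D ∧ b (toggle L y D) = b D) →
      ∃ D, b D = b (g C) ∧ toggle L y D ≠ D ∧ b (toggle L y D) = b D := by
    intro g hg
    refine Subgroup.closure_induction'' (p := fun g _ => ∀ C,
      (∃ D, b D = b C ∧ toggle L y D ≠ D ∧ b (toggle L y D) = b D) →
      ∃ D, b D = b (g C) ∧ toggle L y D ≠ D ∧ b (toggle L y D) = b D) ?_ ?_ ?_ ?_ hg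
    · rintro _ ⟨z, rfl⟩
      exact hstep z
    · rintro _ ⟨z, rfl⟩
      have hinv : (toggle L z)⁻¹ = toggle L z :=
        inv_eq_of_mul_eq_one_right (Equiv.ext (toggle_toggle L z))
      rw [hinv]
      exact hstep z
    · exact fun C h => h
    · exact fun g h _ _ hg hh C hC => hg _ (hh C hC)
  obtain ⟨g, hg, rfl⟩ := htrans A B
  obtain ⟨D, hD, -, hyD⟩ := hgroup g hg A ⟨A, rfl, hne, hA⟩
  exact (hb y _ _ hD).symm.trans (hyD.trans hD)

/-- A toggle moving some fibre commutes with every toggle preserving all fibres. -/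
theorem toggle_mul_comm_of_apply (htrans : IsTransitive L)
    (hb : ∀ e A B, b A = b B → b (toggle L e A) = b (toggle L e B)) {x y : E}
    (hx : ∀ A, b (toggle L x A) = b A) (hy : ∃ A, b (toggle L y A) ≠ b A) :
    toggle L x * toggle L y = toggle L y * toggle L x := by
  have hfix : ∀ A, b (toggle L y A) = b A → toggle L y A = A := by
    intro A hA
    by_contra hne
    obtain ⟨B, hB⟩ := hy
    exact hB (apply_toggle_eq_of_ne htrans hb hne hA B)
  have hmove : ∀ A, b (toggle L y A) ≠ b A → toggle L x A ≠ A →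
      toggle L y (toggle L x A) = toggle L x (toggle L y A) := fun A hA hne =>
    toggle_comm_of_ne hne (fun h => hA (congrArg b h)) fun h =>
      hA ((hb y _ _ (hx A)).symm.trans ((congrArg b h).trans (hx A)))
  ext1 A
  simp only [Equiv.Perm.mul_apply]
  by_cases hA : b (toggle L y A) = b A
  · rw [hfix A hA, hfix (toggle L x A) ((hb y _ _ (hx A)).trans (hA.trans (hx A).symm))]
  · by_cases hxA : toggle L x A = A
    · rw [hxA]
      by_contra hne
      have h := hmove (toggle L y A) (by rw [toggle_toggle]; exact Ne.symm hA) hne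
      rw [toggle_toggle, hxA] at h
      have h' := congrArg (toggle L y) h
      rw [toggle_toggle] at h'
      exact hne h'
    · exact (hmove A hA hxA).symm

end BlockMap

/-- every type 1 toggle commutes with every type 2 toggle. -/
theorem type1_toggle_commutes_with_type2_toggle
    [Fintype E] (L : Finset (Finset E))
    (hnt : ∀ e : E, toggle L e ≠ 1)
    (htrans : IsTransitive L)
    (Blocks : Finset (Finset {A : Finset E // A ∈ L}))
    (hBS : IsBlockSystem L Blocks)
    (y : E) (hy : ¬ IsType2 L Blocks (toggle L y))
    (x : E) (hx : IsType2 L Blocks (toggle L x)) :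
    toggle L x * toggle L y = toggle L y * toggle L x := by
  obtain ⟨hne, hpart, himg⟩ := hBS
  choose b hb huniq using hpart
  have hmap : ∀ g ∈ toggleGroup L, ∀ A, b (g A) = Finset.image g (b A) := fun g hg A =>
    (huniq (g A) _ ⟨himg g hg _ (hb A).1, Finset.mem_image_of_mem g (hb A).2⟩).symm
  have htoggle : ∀ e A, b (toggle L e A) = Finset.image (toggle L e) (b A) := fun e =>
    hmap _ (Subgroup.subset_closure ⟨e, rfl⟩)
  refine toggle_mul_comm_of_apply (b := b) htrans
    (fun e A B h => by rw [htoggle, htoggle, h])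
    (fun A => (htoggle x A).trans (hx _ (hb A).1)) ?_
  by_contra! hall
  refine hy fun B hB => ?_
  obtain ⟨A, hA⟩ := hne B hB
  rw [huniq A B ⟨hB, hA⟩, ← htoggle, hall]

end TogglePaper
end

section
/- Let ρ ∈ T(𝓛) be a product of type 2 toggles. If ρ fixes every element of some block 𝓑 (i.e., ρ(A) = A for all A ∈ 𝓑), then ρ is the identity permutation of 𝓛. -/
open scoped symmDiff

namespace TogglePaper

variable {E : Type*} [DecidableEq E]

theorem toggle_val_of_mem {L : Finset (Finset E)} {e : E} {X : {A : Finset E // A ∈ L}}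
    (h : X.1 ∆ ({e} : Finset E) ∈ L) : (toggle L e X).1 = X.1 ∆ ({e} : Finset E) :=
  congrArg Subtype.val (dif_pos h)

theorem toggle_eq_self_of_notMem {L : Finset (Finset E)} {e : E} {X : {A : Finset E // A ∈ L}}
    (h : X.1 ∆ ({e} : Finset E) ∉ L) : toggle L e X = X :=
  dif_neg h

theorem toggle_mem_toggleGroup (L : Finset (Finset E)) (e : E) :
    toggle L e ∈ toggleGroup L :=
  Subgroup.subset_closure ⟨e, rfl⟩

theorem toggle_inv (L : Finset (Finset E)) (e : E) : (toggle L e)⁻¹ = toggle L e :=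
  rfl

theorem IsType2.apply_mem {L : Finset (Finset E)}
    {Blocks : Finset (Finset {A : Finset E // A ∈ L})} {g : Equiv.Perm {A : Finset E // A ∈ L}}
    (hg : IsType2 L Blocks g) {B : Finset {A : Finset E // A ∈ L}} (hB : B ∈ Blocks)
    {X : {A : Finset E // A ∈ L}} (hX : X ∈ B) : g X ∈ B :=
  hg B hB ▸ Finset.mem_image_of_mem g hX

theorem IsBlockSystem.eq_of_mem {L : Finset (Finset E)}
    {Blocks : Finset (Finset {A : Finset E // A ∈ L})} (hBS : IsBlockSystem L Blocks)
    {B C : Finset {A : Finset E // A ∈ L}} (hB : B ∈ Blocks) (hC : C ∈ Blocks)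
    {X : {A : Finset E // A ∈ L}} (hXB : X ∈ B) (hXC : X ∈ C) : B = C :=
  (hBS.2.1 X).unique ⟨hB, hXB⟩ ⟨hC, hXC⟩

/-- A toggle that moves a block `B` acts on all of `B` by symmetric difference. -/
theorem IsBlockSystem.toggle_val {L : Finset (Finset E)}
    {Blocks : Finset (Finset {A : Finset E // A ∈ L})} (hBS : IsBlockSystem L Blocks)
    {B : Finset {A : Finset E // A ∈ L}} (hB : B ∈ Blocks) {e : E}
    (he : Finset.image (toggle L e) B ≠ B) {X : {A : Finset E // A ∈ L}} (hX : X ∈ B) :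
    (toggle L e X).1 = X.1 ∆ ({e} : Finset E) := by
  by_cases h : X.1 ∆ ({e} : Finset E) ∈ L
  · exact toggle_val_of_mem h
  · refine absurd (hBS.eq_of_mem (hBS.2.2 _ (toggle_mem_toggleGroup L e) B hB) hB ?_ hX) he
    exact Finset.mem_image.2 ⟨X, hX, toggle_eq_self_of_notMem h⟩

/-- On a block moved by `toggle L e`, a type 2 toggle commutes with `toggle L e`. -/
theorem IsBlockSystem.toggle_comm {L : Finset (Finset E)}
    {Blocks : Finset (Finset {A : Finset E // A ∈ L})} (hBS : IsBlockSystem L Blocks)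
    {B : Finset {A : Finset E // A ∈ L}} (hB : B ∈ Blocks) {e f : E}
    (he : Finset.image (toggle L e) B ≠ B) (hf : IsType2 L Blocks (toggle L f))
    {X : {A : Finset E // A ∈ L}} (hX : X ∈ B) :
    toggle L f (toggle L e X) = toggle L e (toggle L f X) := by
  have hX' := hBS.toggle_val hB he hX
  by_cases h : X.1 ∆ ({f} : Finset E) ∈ L
  · have hval := hBS.toggle_val hB he (hf.apply_mem hB hX)
    rw [toggle_val_of_mem h, symmDiff_right_comm, ← hX'] at hval
    apply Subtype.ext
    rw [toggle_val_of_mem (hval ▸ Subtype.property _), hval]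
  · rw [toggle_eq_self_of_notMem h]
    by_cases h' : (toggle L e X).1 ∆ ({f} : Finset E) ∈ L
    · have hmem := hf.apply_mem (hBS.2.2 _ (toggle_mem_toggleGroup L e) B hB)
        (Finset.mem_image_of_mem (toggle L e) hX)
      obtain ⟨Y, hY, hYX⟩ := Finset.mem_image.1 hmem
      have hval := congrArg Subtype.val hYX
      rw [hBS.toggle_val hB he hY, toggle_val_of_mem h', hX', symmDiff_right_comm] at hval
      exact absurd (symmDiff_left_injective _ hval ▸ Y.2) h
    · exact toggle_eq_self_of_notMem h'

theorem IsBlockSystem.prod_toggle_comm {L : Finset (Finset E)}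
    {Blocks : Finset (Finset {A : Finset E // A ∈ L})} (hBS : IsBlockSystem L Blocks)
    {B : Finset {A : Finset E // A ∈ L}} (hB : B ∈ Blocks) {e : E}
    (he : Finset.image (toggle L e) B ≠ B) (l : List E)
    (hl : ∀ f ∈ l, IsType2 L Blocks (toggle L f))
    {X : {A : Finset E // A ∈ L}} (hX : X ∈ B) :
    (l.map (toggle L)).prod X ∈ B ∧
      (l.map (toggle L)).prod (toggle L e X) = toggle L e ((l.map (toggle L)).prod X) := by
  induction l with
  | nil => simpa using hX
  | cons f l ih =>
    obtain ⟨hmem, hcomm⟩ := ih fun f' hf' => hl f' (List.mem_cons_of_mem _ hf')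
    have hf := hl f List.mem_cons_self
    simp only [List.map_cons, List.prod_cons, Equiv.Perm.mul_apply]
    exact ⟨hf.apply_mem hB hmem, by rw [hcomm, hBS.toggle_comm hB he hf hmem]⟩

/-- If a product of type 2 toggles fixes a block pointwise, then it fixes pointwise
the image of that block under any toggle. -/
theorem IsBlockSystem.fixes_image_toggle {L : Finset (Finset E)}
    {Blocks : Finset (Finset {A : Finset E // A ∈ L})} (hBS : IsBlockSystem L Blocks)
    {B : Finset {A : Finset E // A ∈ L}} (hB : B ∈ Blocks) (e : E) (l : List E)
    (hl : ∀ f ∈ l, IsType2 L Blocks (toggle L f))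
    (hfix : ∀ A ∈ B, (l.map (toggle L)).prod A = A) :
    ∀ A ∈ Finset.image (toggle L e) B, (l.map (toggle L)).prod A = A := by
  by_cases he : Finset.image (toggle L e) B = B
  · rwa [he]
  · intro A hA
    obtain ⟨X, hX, rfl⟩ := Finset.mem_image.1 hA
    rw [(hBS.prod_toggle_comm hB he l hl hX).2, hfix X hX]

/-- a product of type 2 toggles fixing a block pointwise is the identity. -/
theorem product_of_type2_toggles_fixing_block_is_one
    [Fintype E] (L : Finset (Finset E))
    (hnt : ∀ e : E, toggle L e ≠ 1)
    (htrans : IsTransitive L)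
    (Blocks : Finset (Finset {A : Finset E // A ∈ L}))
    (hBS : IsBlockSystem L Blocks)
    (l : List E) (hl : ∀ e ∈ l, IsType2 L Blocks (toggle L e))
    (B : Finset {A : Finset E // A ∈ L}) (hB : B ∈ Blocks)
    (hfix : ∀ A ∈ B, (l.map (toggle L)).prod A = A) :
    (l.map (toggle L)).prod = 1 := by
  have step (e : E) (g : Equiv.Perm {A : Finset E // A ∈ L}) (hg : g ∈ toggleGroup L)
      (ih : ∀ A ∈ Finset.image g B, (l.map (toggle L)).prod A = A) :
      ∀ A ∈ Finset.image (toggle L e * g) B, (l.map (toggle L)).prod A = A := by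
    have h := hBS.fixes_image_toggle (hBS.2.2 g hg B hB) e l hl ih
    rwa [Finset.image_image] at h
  have key (g : Equiv.Perm {A : Finset E // A ∈ L}) (hg : g ∈ toggleGroup L) :
      ∀ A ∈ Finset.image g B, (l.map (toggle L)).prod A = A := by
    induction hg using Subgroup.closure_induction_left with
    | one => simpa using hfix
    | mul_left x hx y hy ih =>
      obtain ⟨e, rfl⟩ := hx
      exact step e y hy ih
    | inv_mul_cancel x hx y hy ih =>
      obtain ⟨e, rfl⟩ := hx
      rw [toggle_inv]
      exact step e y hy ih
  obtain ⟨b, hb⟩ := hBS.1 B hB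
  ext1 A
  obtain ⟨g, hg, rfl⟩ := htrans b A
  exact key g hg _ (Finset.mem_image_of_mem g hb)

end TogglePaper
end
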